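/- The operators P_{a,i}, Q_{a,i}, E, F on the Fermionic Fock space 𝔉(r) form an 𝔈(r)-representation: E and F are mutually inverse additive automorphisms of 𝔉(r), and for all a, b ∈ ℤ and i, j ∈ [r] one has P_{a,i}∘P_{a,i} = Q_{a,i}∘Q_{a,i} = 0, E∘P_{a,i} = P_{a−1,i}∘E, E∘Q_{a,i} = Q_{a−1,i}∘E, P_{a,i}∘P_{b,j} + P_{b,j}∘P_{a,i} = 0, Q_{a,i}∘Q_{b,j} + Q_{b,j}∘Q_{a,i} = 0, and P_{a,i}∘Q_{b,j} + Q_{b,j}∘P_{a,i} = δ_{ij}δ_{ab}·id. -/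

import Mathlib

/-- An `r`-Maya diagram: a function `ℤ → Finset (Fin r)` which is eventually the full set
`[r]` in the negative direction and eventually empty in the positive direction. -/
structure MayaDiagram (r : ℕ) where
  idx : ℤ → Finset (Fin r)
  eventually_full : ∃ N : ℤ, ∀ a : ℤ, a < N → idx a = Finset.univ
  eventually_empty : ∃ N : ℤ, ∀ a : ℤ, N < a → idx a = ∅

namespace MayaDiagram

variable {r : ℕ}

/-- Replace the value of a Maya diagram at `a` by `J`. -/
def update (m : MayaDiagram r) (a : ℤ) (J : Finset (Fin r)) : MayaDiagram r where
  idx := Function.update m.idx a J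
  eventually_full := by
    obtain ⟨N, hN⟩ := m.eventually_full
    refine ⟨min N a, fun b hb => ?_⟩
    rw [Function.update_of_ne (show b ≠ a by omega)]
    exact hN b (by omega)
  eventually_empty := by
    obtain ⟨N, hN⟩ := m.eventually_empty
    refine ⟨max N a, fun b hb => ?_⟩
    rw [Function.update_of_ne (show b ≠ a by omega)]
    exact hN b (by omega)

/-- The shifted Maya diagram `m⁻`, with `(m⁻)_a := I_{a+1}`. -/
def shiftDown (m : MayaDiagram r) : MayaDiagram r where
  idx := fun a => m.idx (a + 1)
  eventually_full := by
    obtain ⟨N, hN⟩ := m.eventually_full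
    exact ⟨N - 1, fun b hb => hN _ (by omega)⟩
  eventually_empty := by
    obtain ⟨N, hN⟩ := m.eventually_empty
    exact ⟨N, fun b hb => hN _ (by omega)⟩

/-- The shifted Maya diagram `m⁺`, with `(m⁺)_a := I_{a-1}`. -/
def shiftUp (m : MayaDiagram r) : MayaDiagram r where
  idx := fun a => m.idx (a - 1)
  eventually_full := by
    obtain ⟨N, hN⟩ := m.eventually_full
    exact ⟨N, fun b hb => hN _ (by omega)⟩
  eventually_empty := by
    obtain ⟨N, hN⟩ := m.eventually_empty
    exact ⟨N + 1, fun b hb => hN _ (by omega)⟩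

/-- `Σ_{k > a} |I_k|` (a finite sum). -/
noncomputable def tailCard (m : MayaDiagram r) (a : ℤ) : ℕ :=
  ∑ᶠ k ∈ {k : ℤ | a < k}, (m.idx k).card

/-- The central charge `c_m := Σ_{a>0} |I_a| − Σ_{a≤0} (r − |I_a|)`. -/
noncomputable def charge (m : MayaDiagram r) : ℤ :=
  (∑ᶠ a ∈ {a : ℤ | 0 < a}, ((m.idx a).card : ℤ)) -
    ∑ᶠ a ∈ {a : ℤ | a ≤ 0}, ((r : ℤ) - (m.idx a).card)

/-- The weight `w_m := Σ_{a>0} a·|I_a| − Σ_{a≤0} a·(r − |I_a|)`. -/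
noncomputable def weight (m : MayaDiagram r) : ℤ :=
  (∑ᶠ a ∈ {a : ℤ | 0 < a}, a * ((m.idx a).card : ℤ)) -
    ∑ᶠ a ∈ {a : ℤ | a ≤ 0}, a * ((r : ℤ) - (m.idx a).card)

end MayaDiagram

/-- The Fermionic Fock space `𝔉(r)`: the free ℤ-module on the `r`-Maya diagrams. -/
abbrev Fock (r : ℕ) := MayaDiagram r →₀ ℤ

/-- `#{j ∈ I : j < i}`. -/
def signCount {r : ℕ} (I : Finset (Fin r)) (i : Fin r) : ℕ :=
  (I.filter (fun j => j < i)).card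

/-- The operator `P_{a,i}` on the Fock space. -/
noncomputable def PF {r : ℕ} (a : ℤ) (i : Fin r) : Module.End ℤ (Fock r) :=
  Finsupp.lift (Fock r) ℤ (MayaDiagram r) fun m =>
    if i ∈ m.idx a then
      ((-1 : ℤ) ^ (m.tailCard a + signCount (m.idx a) i)) •
        Finsupp.single (m.update a ((m.idx a).erase i)) 1
    else 0

/-- The operator `Q_{a,i}` on the Fock space. -/
noncomputable def QF {r : ℕ} (a : ℤ) (i : Fin r) : Module.End ℤ (Fock r) :=
  Finsupp.lift (Fock r) ℤ (MayaDiagram r) fun m =>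
    if i ∈ m.idx a then 0
    else
      ((-1 : ℤ) ^ (m.tailCard a + signCount (m.idx a) i)) •
        Finsupp.single (m.update a (insert i (m.idx a))) 1

/-- The shift operator `E` on the Fock space, `E·v_m := v_{m⁻}`. -/
noncomputable def EF {r : ℕ} : Module.End ℤ (Fock r) :=
  Finsupp.lmapDomain ℤ ℤ MayaDiagram.shiftDown

/-- The shift operator `F` on the Fock space, `F·v_m := v_{m⁺}`. -/
noncomputable def FF {r : ℕ} : Module.End ℤ (Fock r) :=
  Finsupp.lmapDomain ℤ ℤ MayaDiagram.shiftUp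

/-- The component `𝔉(r)_{l,n}` of the Fock space spanned by basis vectors of central
charge `l` and weight `n`. -/
noncomputable def FockComp (r : ℕ) (l n : ℤ) : Submodule ℤ (Fock r) :=
  Submodule.span ℤ
    {x | ∃ m : MayaDiagram r, m.charge = l ∧ m.weight = n ∧ x = Finsupp.single m 1}

namespace MayaDiagram

variable {r : ℕ}

lemma ext_idx {m n : MayaDiagram r} (h : ∀ a, m.idx a = n.idx a) : m = n := by
  cases m; cases n
  simp only [mk.injEq]
  exact funext h

lemma tailCard_eq_sum (m : MayaDiagram r) (a : ℤ) {N : ℤ} (hN : ∀ k, N < k → m.idx k = ∅) :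
    m.tailCard a = ∑ k ∈ Finset.Ioc a N, (m.idx k).card := by
  unfold tailCard
  refine finsum_mem_eq_sum_of_inter_support_eq _ ?_
  ext k
  simp only [Set.mem_inter_iff, Set.mem_ofPred_eq, Function.mem_support, Finset.coe_Ioc,
    Set.mem_Ioc, and_congr_left_iff]
  intro hk
  have : k ≤ N := by
    by_contra! h
    simp [hN k h] at hk
  simp [this]

lemma tailCard_shiftDown (m : MayaDiagram r) (a : ℤ) :
    m.shiftDown.tailCard a = m.tailCard (a + 1) := by
  obtain ⟨N, hN⟩ := m.eventually_empty
  rw [m.tailCard_eq_sum (a + 1) (N := N + 1) fun k hk => hN k (by omega),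
    m.shiftDown.tailCard_eq_sum a (N := N) fun k hk => hN (k + 1) (by omega),
    ← Finset.image_add_right_Ioc, Finset.sum_image (by simp)]
  rfl

lemma tailCard_update_of_le (m : MayaDiagram r) {a b : ℤ} (h : b ≤ a) (J : Finset (Fin r)) :
    (m.update b J).tailCard a = m.tailCard a := by
  refine finsum_mem_congr rfl fun k (hk : a < k) => ?_
  simp [update, Function.update_of_ne (show k ≠ b by omega)]

lemma tailCard_update_of_lt (m : MayaDiagram r) {a b : ℤ} (h : a < b) (J : Finset (Fin r)) :
    (m.update b J).tailCard a + (m.idx b).card = m.tailCard a + J.card := by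
  obtain ⟨N, hN⟩ := m.eventually_empty
  have hb : b ∈ Finset.Ioc a (max N b) := by simp [h]
  rw [m.tailCard_eq_sum a (N := max N b) fun k hk => hN k (by omega),
    (m.update b J).tailCard_eq_sum a (N := max N b) fun k hk => ?_,
    ← Finset.add_sum_erase _ _ hb, ← Finset.add_sum_erase _ (fun k => (m.idx k).card) hb,
    Finset.sum_congr rfl fun k hk => ?_]
  · simp only [update, Function.update_self]
    ring
  · simp [update, Function.update_of_ne (Finset.ne_of_mem_erase hk)]
  · simp only [update]
    rw [Function.update_of_ne (by omega)]
    exact hN k (by omega)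

/-- Toggle the occupation of the site `(a, i)`. -/
def toggle (m : MayaDiagram r) (a : ℤ) (i : Fin r) : MayaDiagram r :=
  m.update a (symmDiff (m.idx a) {i})

/-- The sign with which `P_{a,i}` and `Q_{a,i}` act on `v_m`. -/
noncomputable def siteSign (m : MayaDiagram r) (a : ℤ) (i : Fin r) : ℤ :=
  (-1) ^ (m.tailCard a + signCount (m.idx a) i)

lemma siteSign_mul_self (m : MayaDiagram r) (a : ℤ) (i : Fin r) :
    m.siteSign a i * m.siteSign a i = 1 := by
  rw [siteSign, ← mul_pow]
  simp

lemma mem_toggle {m : MayaDiagram r} {a b : ℤ} {i j : Fin r} :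
    i ∈ (m.toggle b j).idx a ↔ Xor (i ∈ m.idx a) (a = b ∧ i = j) := by
  by_cases h : a = b
  · subst h
    simp [toggle, update, Finset.mem_symmDiff, Xor]
  · simp [toggle, update, h, Xor]

lemma toggle_comm (m : MayaDiagram r) (a b : ℤ) (i j : Fin r) :
    (m.toggle a i).toggle b j = (m.toggle b j).toggle a i := by
  refine ext_idx fun c => Finset.ext fun k => ?_
  simp only [mem_toggle, Xor]
  tauto

lemma toggle_toggle (m : MayaDiagram r) (a : ℤ) (i : Fin r) :
    (m.toggle a i).toggle a i = m := by
  refine ext_idx fun c => Finset.ext fun k => ?_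
  simp only [mem_toggle, Xor]
  tauto

lemma toggle_of_mem {m : MayaDiagram r} {a : ℤ} {i : Fin r} (h : i ∈ m.idx a) :
    m.toggle a i = m.update a ((m.idx a).erase i) := by
  unfold toggle
  congr 1
  ext k
  by_cases hk : k = i <;> simp [Finset.mem_symmDiff, hk, h]

lemma toggle_of_notMem {m : MayaDiagram r} {a : ℤ} {i : Fin r} (h : i ∉ m.idx a) :
    m.toggle a i = m.update a (insert i (m.idx a)) := by
  unfold toggle
  congr 1
  ext k
  by_cases hk : k = i <;> simp [Finset.mem_symmDiff, hk, h]

lemma toggle_shiftDown (m : MayaDiagram r) (a : ℤ) (i : Fin r) :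
    m.shiftDown.toggle (a - 1) i = (m.toggle a i).shiftDown := by
  refine ext_idx fun c => Finset.ext fun k => ?_
  change _ ↔ k ∈ (m.toggle a i).idx (c + 1)
  simp only [mem_toggle, shiftDown, eq_sub_iff_add_eq]

lemma siteSign_shiftDown (m : MayaDiagram r) (a : ℤ) (i : Fin r) :
    m.shiftDown.siteSign (a - 1) i = m.siteSign a i := by
  have hidx : m.shiftDown.idx (a - 1) = m.idx a := by simp [shiftDown]
  rw [siteSign, siteSign, tailCard_shiftDown, hidx, sub_add_cancel]

end MayaDiagram

lemma neg_one_pow_card_symmDiff_singleton {α : Type*} [DecidableEq α] (s : Finset α) (x : α) :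
    (-1 : ℤ) ^ (symmDiff s {x}).card = -(-1) ^ s.card := by
  by_cases h : x ∈ s
  · have : symmDiff s {x} = s.erase x := by
      ext k
      by_cases hk : k = x <;> simp [Finset.mem_symmDiff, hk, h]
    rw [this, ← Finset.card_erase_add_one h, pow_succ]
    ring
  · have : symmDiff s {x} = insert x s := by
      ext k
      by_cases hk : k = x <;> simp [Finset.mem_symmDiff, hk, h]
    rw [this, Finset.card_insert_of_notMem h, pow_succ]
    ring

lemma neg_one_pow_signCount_symmDiff {r : ℕ} (I : Finset (Fin r)) (i j : Fin r) :
    (-1 : ℤ) ^ signCount (symmDiff I {j}) i =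
      (if j < i then -1 else 1) * (-1) ^ signCount I i := by
  unfold signCount
  split_ifs with h
  · have : (symmDiff I {j}).filter (· < i) = symmDiff (I.filter (· < i)) {j} := by
      ext k
      by_cases hk : k = j <;> simp [Finset.mem_symmDiff, hk, h]
    rw [this, neg_one_pow_card_symmDiff_singleton]
    ring
  · have : (symmDiff I {j}).filter (· < i) = I.filter (· < i) := by
      ext k
      by_cases hk : k = j <;> simp [Finset.mem_symmDiff, hk, h]
    rw [this, one_mul]

namespace MayaDiagram

variable {r : ℕ}

lemma siteSign_toggle (m : MayaDiagram r) (a b : ℤ) (i j : Fin r) :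
    (m.toggle b j).siteSign a i =
      (if a < b ∨ a = b ∧ j < i then -1 else 1) * m.siteSign a i := by
  unfold siteSign
  rcases lt_trichotomy a b with h | rfl | h
  · have hidx : (m.toggle b j).idx a = m.idx a := Function.update_of_ne h.ne _ _
    have ht := congrArg (fun n => (-1 : ℤ) ^ n)
      (m.tailCard_update_of_lt h (symmDiff (m.idx b) {j}))
    simp only [pow_add, neg_one_pow_card_symmDiff_singleton] at ht
    have hc : (-1 : ℤ) ^ (m.idx b).card ≠ 0 := by simp
    have ht' : (-1 : ℤ) ^ (m.toggle b j).tailCard a = -(-1) ^ m.tailCard a :=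
      mul_right_cancel₀ hc (by rw [toggle, ht]; ring)
    rw [hidx, pow_add, ht', if_pos (Or.inl h)]
    ring
  · have hidx : (m.toggle a j).idx a = symmDiff (m.idx a) {j} := Function.update_self _ _ _
    rw [hidx, toggle, tailCard_update_of_le _ le_rfl, pow_add, neg_one_pow_signCount_symmDiff]
    simp only [lt_irrefl, true_and, false_or]
    ring
  · have hidx : (m.toggle b j).idx a = m.idx a := Function.update_of_ne h.ne' _ _
    rw [hidx, toggle, tailCard_update_of_le _ h.le, if_neg (by omega), one_mul]

lemma siteSign_toggle_self (m : MayaDiagram r) (a : ℤ) (i : Fin r) :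
    (m.toggle a i).siteSign a i = m.siteSign a i := by
  simp [siteSign_toggle]

lemma siteSign_mul_siteSign_toggle (m : MayaDiagram r) {a b : ℤ} {i j : Fin r}
    (h : ¬(i = j ∧ a = b)) :
    m.siteSign b j * (m.toggle b j).siteSign a i =
      -(m.siteSign a i * (m.toggle a i).siteSign b j) := by
  rw [siteSign_toggle, siteSign_toggle]
  split_ifs with h₁ h₂ h₂
  · omega
  · ring
  · ring
  · omega

end MayaDiagram

/-- The operator toggling the site `(a, i)` with its sign on the basis vectors for which the site
is occupied (`s = true`) or empty (`s = false`), and vanishing on the others. -/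
noncomputable def siteOp {r : ℕ} (s : Bool) (a : ℤ) (i : Fin r) : Module.End ℤ (Fock r) :=
  Finsupp.lift (Fock r) ℤ (MayaDiagram r) fun m =>
    if decide (i ∈ m.idx a) = s then Finsupp.single (m.toggle a i) (m.siteSign a i) else 0

section SiteOp

variable {r : ℕ}

lemma siteOp_single (s : Bool) (a : ℤ) (i : Fin r) (m : MayaDiagram r) (c : ℤ) :
    siteOp s a i (Finsupp.single m c) =
      if decide (i ∈ m.idx a) = s then Finsupp.single (m.toggle a i) (c * m.siteSign a i)
      else 0 := by
  simp [siteOp]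

lemma PF_eq_siteOp (a : ℤ) (i : Fin r) : PF a i = siteOp true a i := by
  unfold PF siteOp
  congr 1
  funext m
  by_cases h : i ∈ m.idx a <;> simp [h, MayaDiagram.toggle_of_mem, MayaDiagram.siteSign]

lemma QF_eq_siteOp (a : ℤ) (i : Fin r) : QF a i = siteOp false a i := by
  unfold QF siteOp
  congr 1
  funext m
  by_cases h : i ∈ m.idx a <;> simp [h, MayaDiagram.toggle_of_notMem, MayaDiagram.siteSign]

lemma Fock.end_ext {f g : Module.End ℤ (Fock r)}
    (h : ∀ m, f (Finsupp.single m 1) = g (Finsupp.single m 1)) : f = g :=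
  Finsupp.lhom_ext' fun m => LinearMap.ext_ring (h m)

lemma EF_mul_siteOp (s : Bool) (a : ℤ) (i : Fin r) :
    EF * siteOp s a i = siteOp s (a - 1) i * EF := by
  refine Fock.end_ext fun m => ?_
  have hidx : m.shiftDown.idx (a - 1) = m.idx a := by simp [MayaDiagram.shiftDown]
  simp only [Module.End.mul_apply, EF, Finsupp.lmapDomain_apply, Finsupp.mapDomain_single,
    siteOp_single, hidx, MayaDiagram.toggle_shiftDown, MayaDiagram.siteSign_shiftDown]
  split_ifs <;> simp [Finsupp.mapDomain_single]

lemma siteOp_mul_self (s : Bool) (a : ℤ) (i : Fin r) : siteOp s a i * siteOp s a i = 0 := by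
  refine Fock.end_ext fun m => ?_
  by_cases h : i ∈ m.idx a <;> cases s <;>
    simp [siteOp_single, MayaDiagram.mem_toggle, Xor, h]

lemma siteOp_anticomm (s t : Bool) {a b : ℤ} {i j : Fin r} (h : ¬(i = j ∧ a = b)) :
    siteOp s a i * siteOp t b j + siteOp t b j * siteOp s a i = 0 := by
  refine Fock.end_ext fun m => ?_
  have h₁ : i ∈ (m.toggle b j).idx a ↔ i ∈ m.idx a := by
    simp only [MayaDiagram.mem_toggle, Xor]
    tauto
  have h₂ : j ∈ (m.toggle a i).idx b ↔ j ∈ m.idx b := by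
    simp only [MayaDiagram.mem_toggle, Xor, eq_comm (a := b), eq_comm (a := j)]
    tauto
  simp only [LinearMap.add_apply, Module.End.mul_apply, siteOp_single, one_mul]
  by_cases hs : decide (i ∈ m.idx a) = s <;> by_cases ht : decide (j ∈ m.idx b) = t <;>
    simp only [hs, ht, if_true, if_false, siteOp_single, h₁, h₂, map_zero, add_zero,
      LinearMap.zero_apply]
  rw [MayaDiagram.siteSign_mul_siteSign_toggle m h, m.toggle_comm, ← Finsupp.single_add]
  simp

lemma siteOp_true_false_anticomm (a : ℤ) (i : Fin r) :
    siteOp true a i * siteOp false a i + siteOp false a i * siteOp true a i = 1 := by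
  refine Fock.end_ext fun m => ?_
  by_cases h : i ∈ m.idx a <;>
    simp [siteOp_single, MayaDiagram.mem_toggle, Xor, h, MayaDiagram.toggle_toggle,
      MayaDiagram.siteSign_toggle_self, MayaDiagram.siteSign_mul_self]

lemma siteOp_anticomm_same (s : Bool) (a b : ℤ) (i j : Fin r) :
    siteOp s a i * siteOp s b j + siteOp s b j * siteOp s a i = 0 := by
  by_cases h : i = j ∧ a = b
  · obtain ⟨rfl, rfl⟩ := h
    simp [siteOp_mul_self]
  · exact siteOp_anticomm s s h

end SiteOp

lemma EF_mul_FF {r : ℕ} : EF (r := r) * FF = 1 := by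
  refine Fock.end_ext fun m => ?_
  have h : m.shiftUp.shiftDown = m :=
    MayaDiagram.ext_idx fun a => by simp [MayaDiagram.shiftUp, MayaDiagram.shiftDown]
  simp [EF, FF, Finsupp.mapDomain_single, h]

lemma FF_mul_EF {r : ℕ} : FF (r := r) * EF = 1 := by
  refine Fock.end_ext fun m => ?_
  have h : m.shiftDown.shiftUp = m :=
    MayaDiagram.ext_idx fun a => by simp [MayaDiagram.shiftUp, MayaDiagram.shiftDown]
  simp [EF, FF, Finsupp.mapDomain_single, h]

/-!
Statement 7: the operators `P_{a,i}`, `Q_{a,i}`, `E`, `F` on the Fermionic Fock space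
`𝔉(r)` form an `𝔈(r)`-representation.
-/

theorem stmt_7 {r : ℕ} (hr : 0 < r) :
    (EF (r := r) * FF = 1) ∧ (FF (r := r) * EF = 1) ∧
    (∀ (a : ℤ) (i : Fin r), PF a i * PF a i = 0) ∧
    (∀ (a : ℤ) (i : Fin r), QF a i * QF a i = 0) ∧
    (∀ (a : ℤ) (i : Fin r), EF * PF a i = PF (a - 1) i * EF) ∧
    (∀ (a : ℤ) (i : Fin r), EF * QF a i = QF (a - 1) i * EF) ∧
    (∀ (a b : ℤ) (i j : Fin r), PF a i * PF b j + PF b j * PF a i = 0) ∧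
    (∀ (a b : ℤ) (i j : Fin r), QF a i * QF b j + QF b j * QF a i = 0) ∧
    (∀ (a b : ℤ) (i j : Fin r),
      PF a i * QF b j + QF b j * PF a i = if i = j ∧ a = b then 1 else 0) := by
  simp only [PF_eq_siteOp, QF_eq_siteOp]
  refine ⟨EF_mul_FF, FF_mul_EF, siteOp_mul_self true, siteOp_mul_self false, EF_mul_siteOp true,
    EF_mul_siteOp false, siteOp_anticomm_same true, siteOp_anticomm_same false,
    fun a b i j => ?_⟩
  split_ifs with h
  · obtain ⟨rfl, rfl⟩ := h
    exact siteOp_true_false_anticomm a i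
  · exact siteOp_anticomm true false h
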